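/- Let F be a field of characteristic p > 0 equipped with a discrete valuation such that [F:F^p] = p, and let F̂ be the completion of F with respect to this valuation. Then the extension F̂/F is separable; in particular, every element of F̂ that is algebraic over F is separable over F, i.e. F̂/F contains no nontrivial purely inseparable algebraic subextension. -/

import Mathlib

noncomputable section

/-- The subfield `F^p` of `p`-th powers of a field `F` (of characteristic `p`). -/
def pthPowers (F : Type) [Field F] (p : ℕ) : Subfield F :=
  Subfield.closure (Set.range fun x : F => x ^ p)

/-- `[F : F^p]`, the degree of `F` over its subfield of `p`-th powers. -/
def pDegree (F : Type) [Field F] (p : ℕ) : ℕ :=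
  Module.finrank (pthPowers F p) F

theorem indep_aux (p : ℕ) (K : Type) [Field K] (w : Valuation K (WithZero (Multiplicative ℤ)))
    (t : K) (ht : w t = WithZero.exp 1) (y : ℕ → K)
    (h : ∑ i ∈ Finset.range p, t ^ i * y i ^ p = 0) : ∀ i < p, y i = 0 := by
  by_contra! hc
  obtain ⟨i0, hi0, hy0⟩ := hc
  have hp0 : p ≠ 0 := by omega
  have ht0 : t ≠ 0 := by
    rintro rfl
    rw [map_zero] at ht
    exact WithZero.exp_ne_zero ht.symm
  obtain ⟨i, hi, hmax⟩ := Finset.exists_max_image (Finset.range p)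
    (fun i => w (t ^ i * y i ^ p)) ⟨i0, Finset.mem_range.2 hi0⟩
  have hpos0 : 0 < w (t ^ i0 * y i0 ^ p) := by
    rw [zero_lt_iff, w.ne_zero_iff]
    exact mul_ne_zero (pow_ne_zero _ ht0) (pow_ne_zero _ hy0)
  have hpos : 0 < w (t ^ i * y i ^ p) := hpos0.trans_le (hmax i0 (Finset.mem_range.2 hi0))
  have hne : w (t ^ i * y i ^ p) ≠ 0 := hpos.ne'
  have hlt : ∀ j ∈ (Finset.range p).erase i, w (t ^ j * y j ^ p) < w (t ^ i * y i ^ p) := by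
    intro j hj
    obtain ⟨hji, hjp⟩ := Finset.mem_erase.1 hj
    refine lt_of_le_of_ne (hmax j hjp) fun he => hji ?_
    have hnj := hne
    rw [← he] at hnj
    have h1 : w (y i) ≠ 0 := by
      intro h0
      apply hne
      rw [map_mul, map_pow, map_pow, h0, zero_pow hp0, mul_zero]
    have h2 : w (y j) ≠ 0 := by
      intro h0
      apply hnj
      rw [map_mul, map_pow, map_pow, h0, zero_pow hp0, mul_zero]
    have := congrArg WithZero.log he
    simp only [map_mul, map_pow, ht] at this
    rw [WithZero.log_mul (by simp) (by simp [h2]), WithZero.log_mul (by simp) (by simp [h1])] at this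
    simp only [WithZero.log_pow, WithZero.log_exp, nsmul_eq_mul, mul_one] at this
    have hjp' := Finset.mem_range.1 hjp
    have hip' := Finset.mem_range.1 hi
    have hm : (j : ℤ) % p = i % p := by
      have := congrArg (· % (p : ℤ)) this
      simpa using this
    rw [Int.emod_eq_of_lt (by positivity) (by exact_mod_cast hjp'),
      Int.emod_eq_of_lt (by positivity) (by exact_mod_cast hip')] at hm
    exact_mod_cast hm
  have := w.map_sum_lt hne hlt
  rw [← Finset.add_sum_erase _ _ hi] at h
  rw [eq_neg_of_add_eq_zero_left h, Valuation.map_neg] at this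
  exact lt_irrefl _ this

theorem pthPowers_mem (F : Type) [Field F] (p : ℕ) [Fact p.Prime] [CharP F p] (x : F)
    (hx : x ∈ pthPowers F p) : ∃ y, y ^ p = x := by
  have : pthPowers F p ≤ (frobenius F p).fieldRange := by
    refine Subfield.closure_le.2 ?_
    rintro _ ⟨y, rfl⟩
    exact ⟨y, rfl⟩
  exact this hx

theorem decomp_aux (p : ℕ) [Fact p.Prime] (F : Type) [Field F] [CharP F p]
    (w : Valuation F (WithZero (Multiplicative ℤ)))
    (t : F) (ht : w t = WithZero.exp 1) (hF : pDegree F p = p) (a : F) :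
    ∃ b : ℕ → F, a = ∑ i ∈ Finset.range p, t ^ i * b i ^ p := by
  have hli : LinearIndependent (pthPowers F p) (fun i : Fin p => t ^ (i : ℕ)) := by
    rw [Fintype.linearIndependent_iff]
    intro g hg i
    choose y hy using fun i : Fin p => pthPowers_mem F p (g i) (g i).2
    have := indep_aux p F w t ht (fun n => if h : n < p then y ⟨n, h⟩ else 0) (by
      rw [Finset.sum_range]
      rw [← hg]
      refine Finset.sum_congr rfl fun i _ => ?_
      simp [hy, Subfield.smul_def, mul_comm]) i i.2
    simp only [i.2, dite_true] at this
    apply Subtype.ext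
    rw [← hy i]
    simp [this, (Fact.out : p.Prime).ne_zero]
  have : FiniteDimensional (pthPowers F p) F := Module.finite_of_finrank_pos (by
    have h : Module.finrank (pthPowers F p) F = p := hF
    rw [h]
    exact (Fact.out : p.Prime).pos)
  have hs := hli.span_eq_top_of_card_eq_finrank' (by simpa [pDegree] using hF.symm)
  have ha : a ∈ Submodule.span (pthPowers F p) (Set.range fun i : Fin p => t ^ (i : ℕ)) := by
    rw [hs]; trivial
  obtain ⟨c, hc⟩ := (Submodule.mem_span_range_iff_exists_fun _).1 ha
  choose y hy using fun i : Fin p => pthPowers_mem F p (c i) (c i).2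
  refine ⟨fun n => if h : n < p then y ⟨n, h⟩ else 0, ?_⟩
  rw [Finset.sum_range, ← hc]
  refine Finset.sum_congr rfl fun i _ => ?_
  simp [hy, Subfield.smul_def, mul_comm]

theorem sep_aux (p : ℕ) [Fact p.Prime] (F : Type) [Field F] [CharP F p]
    (w : Valuation F (WithZero (Multiplicative ℤ)))
    (t : F) (ht : w t = WithZero.exp 1) (hF : pDegree F p = p)
    (K : Type) [Field K] [Algebra F K] (v : Valuation K (WithZero (Multiplicative ℤ)))
    (hv : v (algebraMap F K t) = WithZero.exp 1) (x : K) (hx : IsAlgebraic F x) :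
    IsSeparable F x := by
  have hp : p.Prime := Fact.out
  have : CharP K p := charP_of_injective_algebraMap (algebraMap F K).injective p
  have hirr := minpoly.irreducible hx.isIntegral
  rcases Polynomial.separable_or p hirr with h | ⟨-, g, hg, hgf⟩
  · exact h
  exfalso
  choose b hb using decomp_aux p F w t ht hF
  have h0 := minpoly.aeval F x
  rw [← hgf, Polynomial.expand_aeval, Polynomial.aeval_eq_sum_range] at h0
  have hdeg : (minpoly F x).natDegree = g.natDegree * p := by
    rw [← hgf, Polynomial.natDegree_expand]
  have hpos := minpoly.natDegree_pos hx.isIntegral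
  let q : ℕ → Polynomial F := fun i =>
    ∑ j ∈ Finset.range (g.natDegree + 1), Polynomial.monomial j (b (g.coeff j) i)
  have key := indep_aux p K v (algebraMap F K t) hv (fun i => Polynomial.aeval x (q i)) (by
    rw [← h0]
    have e : ∀ i, (Polynomial.aeval x (q i)) ^ p = ∑ j ∈ Finset.range (g.natDegree + 1),
        (algebraMap F K (b (g.coeff j) i)) ^ p * (x ^ p) ^ j := by
      intro i
      simp only [q, map_sum, Polynomial.aeval_monomial]
      rw [sum_pow_char]
      refine Finset.sum_congr rfl fun j _ => ?_
      rw [mul_pow, ← pow_mul, ← pow_mul, mul_comm j]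
    simp only [e, Finset.mul_sum]
    rw [Finset.sum_comm]
    refine Finset.sum_congr rfl fun j _ => ?_
    conv_rhs => rw [hb (g.coeff j)]
    rw [Algebra.smul_def, map_sum, Finset.sum_mul]
    refine Finset.sum_congr rfl fun i _ => ?_
    simp only [map_mul, map_pow, mul_assoc])
  have hq : ∀ i < p, q i = 0 := by
    intro i hi
    by_contra hne
    have h1 := Polynomial.natDegree_le_of_dvd (minpoly.dvd F x (key i hi)) hne
    have h2 : (q i).natDegree ≤ g.natDegree := by
      refine Polynomial.natDegree_sum_le_of_forall_le _ _ fun j hj => ?_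
      exact (Polynomial.natDegree_monomial_le _).trans (by have := Finset.mem_range.1 hj; omega)
    have h3 := hp.two_le
    have : 0 < g.natDegree := by
      rw [hdeg] at hpos
      exact Nat.pos_of_mul_pos_right hpos
    nlinarith
  apply hg.ne_zero
  ext j
  rw [Polynomial.coeff_zero]
  by_cases hj : j < g.natDegree + 1
  · rw [hb (g.coeff j)]
    refine Finset.sum_eq_zero fun i hi => ?_
    have := congrArg (Polynomial.coeff · j) (hq i (Finset.mem_range.1 hi))
    simp only [q, Polynomial.finsetSum_coeff, Polynomial.coeff_monomial, Polynomial.coeff_zero,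
      Finset.sum_ite_eq', Finset.mem_range, hj, if_true] at this
    simp [this, hp.ne_zero]
  · exact Polynomial.coeff_eq_zero_of_natDegree_lt (by omega)

/-- Let `F` be a field of characteristic `p > 0` equipped with a
discrete valuation (a valuation with value group `ℤ`, surjective onto the value group)
such that `[F:F^p] = p`, and let `F̂` be the completion of `F`.  Then `F̂/F` is
separable: every element of `F̂` that is algebraic over `F` is separable over `F`. -/
theorem completion_is_separable
    (p : ℕ) [Fact p.Prime]
    (F : Type) [Field F] [CharP F p] [Valued F (WithZero (Multiplicative ℤ))]
    (hsurj : Function.Surjective (Valued.v : F → WithZero (Multiplicative ℤ)))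
    (hF : pDegree F p = p) :
    ∀ x : UniformSpace.Completion F, IsAlgebraic F x → IsSeparable F x := by
  intro x hx
  obtain ⟨t, ht⟩ := hsurj (WithZero.exp 1)
  exact sep_aux p F Valued.v t ht hF (UniformSpace.Completion F) Valued.v
    ((Valued.valuedCompletion_apply t).trans ht) x hx
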